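/- arXiv:1610.09741 — 11 statements merged into one kernel-verified Lean document; each statement's English description precedes it below -/
import Mathlib

section
/- Every maximal nested set on a diagram D has cardinality |D| + 1, where |D| denotes the number of vertices of D. -/
/-- Two subdiagrams (finite vertex sets) of a diagram `G` are *orthogonal* if they are
disjoint and no edge of `G` joins a vertex of one to a vertex of the other. -/
def Diagram.Orthogonal {V : Type*} (G : SimpleGraph V) (B₁ B₂ : Finset V) : Prop :=
  Disjoint B₁ B₂ ∧ ∀ i ∈ B₁, ∀ j ∈ B₂, ¬ G.Adj i j

/-- Two subdiagrams are *compatible* if one contains the other or they are orthogonal. -/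
def Diagram.Compatible {V : Type*} (G : SimpleGraph V) (B₁ B₂ : Finset V) : Prop :=
  B₁ ⊆ B₂ ∨ B₂ ⊆ B₁ ∨ Diagram.Orthogonal G B₁ B₂

/-- A subdiagram is *connected* if the induced subgraph is connected. -/
def Diagram.IsConnSub {V : Type*} (G : SimpleGraph V) (C : Finset V) : Prop :=
  (G.induce (C : Set V)).Connected

/-- `C` is a connected component of the subdiagram `B`: it is a connected subset of `B`
which is maximal among connected subsets of `B`. -/
def Diagram.IsCC {V : Type*} (G : SimpleGraph V) (B C : Finset V) : Prop :=
  C ⊆ B ∧ Diagram.IsConnSub G C ∧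
    ∀ C' : Finset V, C ⊆ C' → C' ⊆ B → Diagram.IsConnSub G C' → C' = C

/-- A *nested set* on the diagram `G` (on the full vertex set): a collection of pairwise
compatible connected subdiagrams which contains the empty subdiagram and every connected
component of the diagram. -/
def Diagram.IsNestedSet {V : Type*} [Fintype V] (G : SimpleGraph V)
    (H : Finset (Finset V)) : Prop :=
  (∀ C ∈ H, C = ∅ ∨ Diagram.IsConnSub G C) ∧
  (∀ C₁ ∈ H, ∀ C₂ ∈ H, Diagram.Compatible G C₁ C₂) ∧
  (∅ : Finset V) ∈ H ∧
  ∀ C : Finset V, Diagram.IsCC G Finset.univ C → C ∈ H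

/-- A *maximal nested set*: a nested set maximal with respect to inclusion. -/
def Diagram.IsMaxNestedSet {V : Type*} [Fintype V] (G : SimpleGraph V)
    (H : Finset (Finset V)) : Prop :=
  Diagram.IsNestedSet G H ∧
    ∀ H' : Finset (Finset V), Diagram.IsNestedSet G H' → H ⊆ H' → H' = H

namespace Diagram

variable {V : Type*} {G : SimpleGraph V}

theorem isConnSub_singleton (v : V) : IsConnSub G {v} := by
  have : Subsingleton (({v} : Finset V) : Set V) := by
    rw [Finset.coe_singleton]
    infer_instance
  have : Nonempty (({v} : Finset V) : Set V) := ⟨⟨v, by simp⟩⟩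
  exact ⟨.of_subsingleton⟩

theorem Orthogonal.mono {B₁ B₂ C₁ C₂ : Finset V} (h : Orthogonal G B₁ B₂) (h₁ : C₁ ⊆ B₁)
    (h₂ : C₂ ⊆ B₂) : Orthogonal G C₁ C₂ :=
  ⟨h.1.mono h₁ h₂, fun i hi j hj ↦ h.2 i (h₁ hi) j (h₂ hj)⟩

theorem Orthogonal.symm {B₁ B₂ : Finset V} (h : Orthogonal G B₁ B₂) : Orthogonal G B₂ B₁ :=
  ⟨h.1.symm, fun i hi j hj hij ↦ h.2 j hj i hi hij.symm⟩

theorem Compatible.symm {B₁ B₂ : Finset V} (h : Compatible G B₁ B₂) : Compatible G B₂ B₁ := by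
  rcases h with h | h | h
  · exact .inr (.inl h)
  · exact .inl h
  · exact .inr (.inr h.symm)

/-- The union of two connected subdiagrams that are not orthogonal is connected. -/
theorem IsConnSub.union [DecidableEq V] {A B : Finset V} (hA : IsConnSub G A)
    (hB : IsConnSub G B) (h : ¬ Orthogonal G A B) : IsConnSub G (A ∪ B) := by
  unfold IsConnSub at *
  rw [Finset.coe_union]
  by_cases hd : Disjoint A B
  · simp only [Orthogonal, hd, true_and, not_forall, not_not] at h
    obtain ⟨i, hi, j, hj, hij⟩ := h
    exact SimpleGraph.connected_induce_union hA.preconnected hB.preconnected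
      (Finset.mem_coe.2 hi) (Finset.mem_coe.2 hj) hij
  · obtain ⟨i, hi, hi'⟩ := Finset.not_disjoint_iff.1 hd
    exact SimpleGraph.induce_union_connected hA.preconnected hB.preconnected ⟨i, hi, hi'⟩

/-- A connected subdiagram has an edge leaving each of its nonempty proper subdiagrams. -/
theorem IsConnSub.exists_adj {B C : Finset V} (hB : IsConnSub G B) (hCB : C ⊂ B)
    (hC : C.Nonempty) : ∃ i ∈ C, ∃ j ∈ B, j ∉ C ∧ G.Adj i j := by
  obtain ⟨i, hi⟩ := hC
  obtain ⟨j, hj, hjC⟩ := Finset.exists_of_ssubset hCB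
  obtain ⟨p⟩ := hB.preconnected ⟨i, hCB.1 hi⟩ ⟨j, hj⟩
  obtain ⟨d, -, hd, hd'⟩ := p.exists_boundary_dart {x | (x : V) ∈ C} hi hjC
  exact ⟨d.fst, hd, d.snd, d.snd.2, hd', d.adj⟩

/-- Every vertex of a subdiagram lies in a connected component of it. -/
theorem exists_isCC {B : Finset V} {v : V} (hv : v ∈ B) : ∃ C, IsCC G B C ∧ v ∈ C := by
  have hfin : {C : Finset V | C ⊆ B ∧ v ∈ C ∧ IsConnSub G C}.Finite :=
    B.powerset.finite_toSet.subset fun C hC ↦ Finset.mem_coe.2 (Finset.mem_powerset.2 hC.1)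
  obtain ⟨C, ⟨hCB, hvC, hC⟩, hmax⟩ := hfin.exists_maximal
    ⟨{v}, by simpa using hv, by simp, isConnSub_singleton v⟩
  exact ⟨C, ⟨hCB, hC, fun C' hCC' hC'B hC' ↦
    (hmax ⟨hC'B, hCC' hvC, hC'⟩ hCC').antisymm hCC'⟩, hvC⟩

/-- A connected subdiagram of `B` is compatible with every connected component of `B`. -/
theorem IsCC.compatible {A B C : Finset V} (hC : IsCC G B C) (hA : IsConnSub G A)
    (hAB : A ⊆ B) : Compatible G A C := by
  classical
  by_cases h : Orthogonal G A C
  · exact .inr (.inr h)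
  · left
    rw [← hC.2.2 _ Finset.subset_union_right (Finset.union_subset hAB hC.1)
      (hA.union hC.2.1 h)]
    exact Finset.subset_union_left

variable [Fintype V] {H : Finset (Finset V)}

theorem IsNestedSet.isConnSub (hH : IsNestedSet G H) {B : Finset V} (hB : B ∈ H)
    (hne : B.Nonempty) : IsConnSub G B :=
  (hH.1 B hB).resolve_left hne.ne_empty

/-- Among the members of a nested set that contain a given vertex there is a least one. -/
theorem IsNestedSet.exists_least (hH : IsNestedSet G H) (v : V) :
    ∃ B ∈ H, v ∈ B ∧ ∀ A ∈ H, v ∈ A → B ⊆ A := by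
  classical
  obtain ⟨C, hC, hvC⟩ := exists_isCC (G := G) (Finset.mem_univ v)
  obtain ⟨B, hB, hmin⟩ := (H.filter (v ∈ ·)).exists_minimal
    ⟨C, Finset.mem_filter.2 ⟨hH.2.2.2 C hC, hvC⟩⟩
  obtain ⟨hBH, hvB⟩ := Finset.mem_filter.1 hB
  refine ⟨B, hBH, hvB, fun A hA hvA ↦ ?_⟩
  rcases hH.2.1 B hBH A hA with h | h | h
  · exact h
  · exact hmin (Finset.mem_filter.2 ⟨hA, hvA⟩) h
  · exact absurd hvA (Finset.disjoint_left.1 h.1 hvB)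

/-- Every nonempty member of a nested set has a vertex that lies in no smaller member. -/
theorem IsNestedSet.exists_vertex (hH : IsNestedSet G H) {B : Finset V} (hB : B ∈ H)
    (hne : B.Nonempty) : ∃ v ∈ B, ∀ A ∈ H, v ∈ A → ¬ A ⊂ B := by
  classical
  by_contra! hcon
  obtain ⟨v, hv⟩ := hne
  obtain ⟨A, hA, hvA, hAB⟩ := hcon v hv
  have hfin : {C : Finset V | C ∈ H ∧ C ⊂ B ∧ C.Nonempty}.Finite :=
    H.finite_toSet.subset fun C hC ↦ hC.1
  obtain ⟨C, ⟨hCH, hCB, hC⟩, hmax⟩ := hfin.exists_maximal ⟨A, hA, hAB, v, hvA⟩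
  obtain ⟨i, hi, j, hj, hjC, hij⟩ := (hH.isConnSub hB ⟨v, hv⟩).exists_adj hCB hC
  obtain ⟨D, hD, hjD, hDB⟩ := hcon j hj
  rcases hH.2.1 C hCH D hD with h | h | h
  · exact hjC (hmax ⟨hD, hDB, j, hjD⟩ h hjD)
  · exact hjC (h hjD)
  · exact h.2 i hi j hjD hij

/-- Of two distinct vertices of a member of a maximal nested set, at least one lies in a
smaller member. -/
theorem IsMaxNestedSet.exists_ssubset (hH : IsMaxNestedSet G H) {B : Finset V} (hB : B ∈ H)
    {v w : V} (hv : v ∈ B) (hw : w ∈ B) (hvw : v ≠ w) :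
    ∃ A ∈ H, A ⊂ B ∧ (v ∈ A ∨ w ∈ A) := by
  classical
  by_contra! hcon
  obtain ⟨C, hC, hvC⟩ := exists_isCC (G := G) (Finset.mem_erase.2 ⟨hvw, hv⟩)
  have hCB : C ⊂ B := hC.1.trans_ssubset (Finset.erase_ssubset hw)
  have hcomp : ∀ A ∈ H, Compatible G A C := by
    intro A hA
    rcases hH.1.2.1 A hA B hB with h | h | h
    · rcases A.eq_empty_or_nonempty with rfl | hne
      · exact .inl (Finset.empty_subset C)
      rcases h.eq_or_ssubset with rfl | h'
      · exact .inr (.inl hCB.1)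
      · exact hC.compatible (hH.1.isConnSub hA hne)
          (Finset.subset_erase.2 ⟨h, (hcon A hA h').2⟩)
    · exact .inr (.inl (hCB.1.trans h))
    · exact .inr (.inr (h.mono subset_rfl hCB.1))
  have hnested : IsNestedSet G (insert C H) := by
    refine ⟨?_, ?_, Finset.mem_insert_of_mem hH.1.2.2.1,
      fun D hD ↦ Finset.mem_insert_of_mem (hH.1.2.2.2 D hD)⟩
    · simp only [Finset.forall_mem_insert]
      exact ⟨.inr hC.2.1, hH.1.1⟩
    · simp only [Finset.forall_mem_insert]
      exact ⟨⟨.inl subset_rfl, fun A hA ↦ (hcomp A hA).symm⟩,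
        fun A hA ↦ ⟨hcomp A hA, hH.1.2.1 A hA⟩⟩
  have hCH : C ∈ H := by
    rw [← hH.2 _ hnested (Finset.subset_insert C H)]
    exact Finset.mem_insert_self C H
  exact (hcon C hCH hCB).1 hvC

end Diagram

/-- Every maximal nested set on a diagram `D` has cardinality `|D| + 1`. -/
theorem card_maxNestedSet {V : Type*} [Fintype V] [DecidableEq V] (G : SimpleGraph V)
    (H : Finset (Finset V)) (hH : Diagram.IsMaxNestedSet G H) :
    H.card = Fintype.card V + 1 := by
  choose f hfH hf hle using hH.1.exists_least
  have hcard : (Finset.univ : Finset V).card = (H.erase ∅).card := by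
    refine Finset.card_bij (fun v _ ↦ f v)
      (fun v _ ↦ Finset.mem_erase.2 ⟨Finset.ne_empty_of_mem (hf v), hfH v⟩)
      (fun v _ w _ hvw ↦ ?_) fun B hB ↦ ?_
    · by_contra hne
      obtain ⟨A, hA, hAB, h | h⟩ := hH.exists_ssubset (hfH v) (hf v) (hvw ▸ hf w) hne
      · exact hAB.2 (hle v A hA h)
      · exact hAB.2 (hvw ▸ hle w A hA h)
    · obtain ⟨hne, hB⟩ := Finset.mem_erase.1 hB
      obtain ⟨v, hv, hmin⟩ := hH.1.exists_vertex hB (Finset.nonempty_iff_ne_empty.2 hne)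
      exact ⟨v, Finset.mem_univ v,
        (hle v B hB hv).eq_of_not_ssubset (hmin _ (hfH v) (hf v))⟩
  rw [← Finset.card_erase_add_one hH.1.2.2.1, ← hcard, Finset.card_univ]
end

section
/- Let (V, Π, Π∨) be a realisation of A. Then Π⊥ ⊆ V' if and only if dim V = 2|I| − rank(A), i.e. if and only if V is of minimal dimension. -/
/-- A *realisation* of the matrix `A` : the data of a finite-dimensional `k`-vector space
`V`, a linearly independent family `α = {α_i} ⊆ V*`, and a linearly independent family
`hv = {h_i^∨} ⊆ V` such that `α_i (h_j^∨) = a_{ji}` for all `i, j`. -/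
structure IsRealisation {k : Type*} [Field k] {I : Type*} [Fintype I]
    (A : Matrix I I k) (V : Type*) [AddCommGroup V] [Module k V]
    (α : I → (V →ₗ[k] k)) (hv : I → V) : Prop where
  finite : FiniteDimensional k V
  indep_alpha : LinearIndependent k α
  indep_h : LinearIndependent k hv
  pairing : ∀ i j, α i (hv j) = A j i

open Module LinearMap

/-- The common kernel of a linearly independent family of functionals has codimension equal to
the size of the family. -/
theorem card_add_finrank_iInf_ker {k V I : Type*} [Field k] [AddCommGroup V] [Module k V]
    [FiniteDimensional k V] [Fintype I] {α : I → (V →ₗ[k] k)} (hα : LinearIndependent k α) :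
    Fintype.card I + finrank k (⨅ i, ker (α i) : Submodule k V) = finrank k V := by
  have hker : (⨅ i, ker (α i)) = (Submodule.span k (Set.range α)).dualCoannihilator := by
    refine SetLike.coe_injective ?_
    rw [Submodule.coe_dualCoannihilator_span]
    ext x
    simp
  rw [hker, ← finrank_span_eq_card hα]
  exact Subspace.finrank_add_finrank_dualCoannihilator_eq (Submodule.span k (Set.range α))

/-- In a realisation of `A`, the subspace `Π⊥ ∩ V'` has dimension `|I| - rank A`. -/
theorem IsRealisation.rank_add_finrank_iInf_ker_inf_span {k V I : Type*} [Field k]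
    [AddCommGroup V] [Module k V] [Fintype I] {A : Matrix I I k} {α : I → (V →ₗ[k] k)}
    {hv : I → V} (h : IsRealisation A V α hv) :
    A.rank + finrank k ((⨅ i, ker (α i)) ⊓ Submodule.span k (Set.range hv) : Submodule k V) =
      Fintype.card I := by
  have hinj : Function.Injective (Fintype.linearCombination k hv) :=
    linearIndependent_iff_injective_fintypeLinearCombination.mp h.indep_h
  have hcomp : LinearMap.pi α ∘ₗ Fintype.linearCombination k hv = A.vecMulLinear := by
    ext c i
    simp [h.pairing, Fintype.linearCombination_apply, Matrix.vecMul, dotProduct]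
  have hmap : (⨅ i, ker (α i)) ⊓ Submodule.span k (Set.range hv) =
      (ker A.vecMulLinear).map (Fintype.linearCombination k hv) := by
    rw [← hcomp, ker_comp, Submodule.map_comap_eq, ker_pi, Fintype.range_linearCombination,
      inf_comm]
  rw [hmap, ← (Submodule.equivMapOfInjective _ hinj _).finrank_eq, ← A.rank_transpose, Matrix.rank,
    Matrix.mulVecLin_transpose, finrank_range_add_finrank_ker, finrank_fintype_fun_eq_card]

/-- Let `(V, Π, Π∨)` be a realisation of `A`.  Then `Π⊥ ⊆ V'` (the common kernel of the
`α_i` is contained in the span of the `h_i^∨`) if and only if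
`dim V = 2|I| − rank(A)`, i.e. if and only if `V` is of minimal dimension. -/
theorem perp_le_span_iff_minimal {k : Type*} [Field k] [CharZero k] {I : Type*} [Fintype I]
    (A : Matrix I I k) (V : Type*) [AddCommGroup V] [Module k V]
    (α : I → (V →ₗ[k] k)) (hv : I → V) (hreal : IsRealisation A V α hv) :
    (⨅ i, LinearMap.ker (α i)) ≤ Submodule.span k (Set.range hv) ↔
      Module.finrank k V = 2 * Fintype.card I - A.rank := by
  have := hreal.finite
  have hcodim := card_add_finrank_iInf_ker hreal.indep_alpha
  have hinter := hreal.rank_add_finrank_iInf_ker_inf_span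
  rw [← inf_eq_left]
  constructor
  · intro h
    rw [h] at hinter
    omega
  · intro h
    exact Submodule.eq_of_le_of_finrank_eq inf_le_left (by omega)
end

section
/- Let T ∈ Hom_A(V₁, V₂) be a morphism of realisations of A. If V₁ is of minimal dimension 2|I| − rank(A), then T is injective. -/
/-- A *morphism of realisations* `T : (V₁, Π₁, Π₁∨) → (V₂, Π₂, Π₂∨)`: a `k`-linear map
with `T (h_{1,i}^∨) = h_{2,i}^∨` and `α_{2,i} ∘ T = α_{1,i}` for all `i`. -/
def IsRealisationHom {k : Type*} [Field k] {I : Type*}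
    {V₁ : Type*} [AddCommGroup V₁] [Module k V₁]
    {V₂ : Type*} [AddCommGroup V₂] [Module k V₂]
    (α₁ : I → (V₁ →ₗ[k] k)) (hv₁ : I → V₁)
    (α₂ : I → (V₂ →ₗ[k] k)) (hv₂ : I → V₂) (T : V₁ →ₗ[k] V₂) : Prop :=
  (∀ i, T (hv₁ i) = hv₂ i) ∧ ∀ i, (α₂ i).comp T = α₁ i

/-- A linearly independent finite family of linear forms is jointly surjective onto `k ^ I`. -/
theorem LinearIndependent.linearMap_pi_surjective {k : Type*} [Field k] {I : Type*} [Fintype I]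
    {V : Type*} [AddCommGroup V] [Module k V] {α : I → (V →ₗ[k] k)}
    (hα : LinearIndependent k α) : Function.Surjective (LinearMap.pi α) := by
  classical
  rw [← LinearMap.dualMap_injective_iff, injective_iff_map_eq_zero]
  intro φ hφ
  have hsum : ∑ i, φ (Pi.single i 1) • α i = 0 := by
    ext v
    have hv := LinearMap.congr_fun hφ v
    rw [LinearMap.dualMap_apply, LinearMap.pi_apply_eq_sum_univ] at hv
    have hsingle : ∀ i : I, (fun j => if i = j then (1 : k) else 0) = Pi.single i 1 :=
      fun i => funext fun j => by simp [Pi.single_apply, eq_comm]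
    simp only [hsingle] at hv
    simpa [mul_comm] using hv
  have hc := Fintype.linearIndependent_iff.mp hα _ hsum
  ext i
  simpa using hc i

/-- In a minimal realisation, the common kernel of the roots is spanned by coroots. -/
theorem IsRealisation.ker_pi_le_range {k : Type*} [Field k] {I : Type*} [Fintype I]
    {A : Matrix I I k} {V : Type*} [AddCommGroup V] [Module k V]
    {α : I → (V →ₗ[k] k)} {hv : I → V} (h : IsRealisation A V α hv)
    (hmin : Module.finrank k V = 2 * Fintype.card I - A.rank) :
    LinearMap.ker (LinearMap.pi α) ≤ LinearMap.range (Fintype.linearCombination k hv) := by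
  classical
  have := h.finite
  set L := LinearMap.pi α with hL
  set P := Fintype.linearCombination k hv with hP
  have hPinj : Function.Injective P :=
    h.indep_h.fintypeLinearCombination_injective
  have hcomp : L ∘ₗ P = A.transpose.mulVecLin := by
    refine LinearMap.ext fun c => funext fun i => ?_
    simp [hL, hP, Fintype.linearCombination_apply, h.pairing, Matrix.vecMul, dotProduct]
  have hLker := LinearMap.finrank_range_add_finrank_ker L
  rw [LinearMap.range_eq_top.mpr h.indep_alpha.linearMap_pi_surjective, finrank_top,
    Module.finrank_fintype_fun_eq_card] at hLker
  have hLPker := LinearMap.finrank_range_add_finrank_ker (L ∘ₗ P)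
  rw [Module.finrank_fintype_fun_eq_card] at hLPker
  have hrank : Module.finrank k (LinearMap.range (L ∘ₗ P)) = A.rank := by
    rw [hcomp, ← A.rank_transpose, Matrix.rank]
  have hle : (LinearMap.ker (L ∘ₗ P)).map P ≤ LinearMap.ker L := by
    rintro _ ⟨c, hc, rfl⟩
    exact hc
  have hmap : Module.finrank k ((LinearMap.ker (L ∘ₗ P)).map P) =
      Module.finrank k (LinearMap.ker (L ∘ₗ P)) :=
    (Submodule.equivMapOfInjective P hPinj _).finrank_eq.symm
  rw [← Submodule.eq_of_le_of_finrank_eq hle (by omega)]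
  exact LinearMap.map_le_range

/-- Let `T ∈ Hom_A(V₁, V₂)` be a morphism of realisations of `A`.  If `V₁` is of minimal
dimension `2|I| − rank(A)`, then `T` is injective. -/
theorem realisationHom_injective {k : Type*} [Field k] [CharZero k] {I : Type*} [Fintype I]
    (A : Matrix I I k)
    (V₁ : Type*) [AddCommGroup V₁] [Module k V₁]
    (V₂ : Type*) [AddCommGroup V₂] [Module k V₂]
    (α₁ : I → (V₁ →ₗ[k] k)) (hv₁ : I → V₁) (α₂ : I → (V₂ →ₗ[k] k)) (hv₂ : I → V₂)
    (h₁ : IsRealisation A V₁ α₁ hv₁) (h₂ : IsRealisation A V₂ α₂ hv₂)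
    (hmin : Module.finrank k V₁ = 2 * Fintype.card I - A.rank)
    (T : V₁ →ₗ[k] V₂) (hT : IsRealisationHom α₁ hv₁ α₂ hv₂ T) :
    Function.Injective T := by
  rw [injective_iff_map_eq_zero]
  intro x hx
  have hker : x ∈ LinearMap.ker (LinearMap.pi α₁) := by
    ext i
    simp [← hT.2 i, hx]
  obtain ⟨c, rfl⟩ := h₁.ker_pi_le_range hmin hker
  have hc : ∑ i, c i • hv₂ i = 0 := by
    simpa [Fintype.linearCombination_apply, hT.1] using hx
  have hzero : c = 0 := funext (Fintype.linearIndependent_iff.mp h₂.indep_h c hc)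
  rw [hzero, map_zero]
end

section
/- Given two realisations (V₁, Π₁, Π₁∨) and (V₂, Π₂, Π₂∨) of A, the set Hom_A(V₁, V₂) is non-empty. Moreover, for any fixed T₀ ∈ Hom_A(V₁, V₂), the map δ ↦ T₀ + δ ∘ q, where q: V₁ → V₁/V₁' is the quotient map, is a bijection from Hom_k(V₁/V₁', Π₂⊥) onto Hom_A(V₁, V₂); in other words, Hom_A(V₁, V₂) is a torsor over the abelian group Hom_k(V₁/V₁', Π₂⊥). -/
/-- Linearly independent linear forms are jointly surjective. -/
theorem LinearIndependent.surjective_linearMap_pi {k I V : Type*} [Field k] [Fintype I]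
    [AddCommGroup V] [Module k V] {α : I → V →ₗ[k] k} (hα : LinearIndependent k α) :
    Function.Surjective (LinearMap.pi α) := by
  classical
  rw [← LinearMap.dualMap_injective_iff, injective_iff_map_eq_zero]
  intro φ hφ
  have hsum : ∑ i, φ (Pi.single i 1) • α i = 0 := by
    ext v
    have hv : φ (LinearMap.pi α v) = 0 := LinearMap.congr_fun hφ v
    rw [← Finset.univ_sum_single (LinearMap.pi α v), map_sum] at hv
    rw [LinearMap.sum_apply, LinearMap.zero_apply, ← hv]
    refine Finset.sum_congr rfl fun i _ => ?_
    rw [LinearMap.smul_apply, smul_eq_mul, mul_comm, ← smul_eq_mul, ← map_smul,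
      ← Pi.single_smul, smul_eq_mul, mul_one, LinearMap.pi_apply]
  refine LinearMap.pi_ext' fun i => LinearMap.ext_ring ?_
  simpa using Fintype.linearIndependent_iff.1 hα _ hsum i

/-- Given two realisations of `A`, the set `Hom_A(V₁, V₂)` is non-empty.  Moreover, for
any fixed `T₀ ∈ Hom_A(V₁, V₂)`, the map `δ ↦ T₀ + δ ∘ q` (where `q : V₁ → V₁/V₁'` is the
quotient map and `δ` runs over `Hom_k(V₁/V₁', Π₂⊥)`) is a bijection from
`Hom_k(V₁/V₁', Π₂⊥)` onto `Hom_A(V₁, V₂)`; in other words, `Hom_A(V₁, V₂)` is a torsor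
over the abelian group `Hom_k(V₁/V₁', Π₂⊥)`. -/
theorem realisationHom_nonempty_torsor {k : Type*} [Field k] [CharZero k] {I : Type*}
    [Fintype I] (A : Matrix I I k)
    (V₁ : Type*) [AddCommGroup V₁] [Module k V₁]
    (V₂ : Type*) [AddCommGroup V₂] [Module k V₂]
    (α₁ : I → (V₁ →ₗ[k] k)) (hv₁ : I → V₁) (α₂ : I → (V₂ →ₗ[k] k)) (hv₂ : I → V₂)
    (h₁ : IsRealisation A V₁ α₁ hv₁) (h₂ : IsRealisation A V₂ α₂ hv₂) :
    (∃ T : V₁ →ₗ[k] V₂, IsRealisationHom α₁ hv₁ α₂ hv₂ T) ∧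
    ∀ T₀ : V₁ →ₗ[k] V₂, IsRealisationHom α₁ hv₁ α₂ hv₂ T₀ →
      Set.BijOn
        (fun δ : (V₁ ⧸ Submodule.span k (Set.range hv₁)) →ₗ[k]
            ↥(⨅ i, LinearMap.ker (α₂ i)) =>
          T₀ + ((⨅ i, LinearMap.ker (α₂ i)).subtype ∘ₗ δ ∘ₗ
            (Submodule.span k (Set.range hv₁)).mkQ))
        Set.univ {T : V₁ →ₗ[k] V₂ | IsRealisationHom α₁ hv₁ α₂ hv₂ T} := by
  constructor
  · obtain ⟨L, hL⟩ : ∃ L : V₁ →ₗ[k] V₂, ∀ i, L (hv₁ i) = hv₂ i := by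
      obtain ⟨L, hL⟩ := LinearMap.exists_extend
        ((Module.Basis.span h₁.indep_h).constr k hv₂)
      refine ⟨L, fun i => ?_⟩
      have hi := LinearMap.congr_fun hL (Module.Basis.span h₁.indep_h i)
      rw [Module.Basis.constr_basis] at hi
      simpa [Module.Basis.span_apply] using hi
    obtain ⟨s, hs⟩ := LinearMap.exists_rightInverse_of_surjective (LinearMap.pi α₂)
      (LinearMap.range_eq_top.2 h₂.indep_alpha.surjective_linearMap_pi)
    have hs' : ∀ x i, α₂ i (s x) = x i := fun x i =>
      congrFun (LinearMap.congr_fun hs x) i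
    refine ⟨L + s ∘ₗ (LinearMap.pi α₁ - LinearMap.pi α₂ ∘ₗ L), fun j => ?_, fun i => ?_⟩
    · have hj : (LinearMap.pi α₁ - LinearMap.pi α₂ ∘ₗ L) (hv₁ j) = 0 := by
        ext i
        simp [hL, h₁.pairing, h₂.pairing]
      simp only [LinearMap.add_apply, LinearMap.comp_apply, hj, hL, map_zero, add_zero]
    · ext v
      simp [hs']
  · intro T₀ hT₀
    refine ⟨fun δ _ => ⟨fun i => ?_, fun i => ?_⟩, fun δ _ δ' _ h => ?_, fun T hT => ?_⟩
    · have hi : (Submodule.span k (Set.range hv₁)).mkQ (hv₁ i) = 0 :=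
        (Submodule.Quotient.mk_eq_zero _).2 (Submodule.subset_span ⟨i, rfl⟩)
      simp only [LinearMap.add_apply, LinearMap.comp_apply, hi, map_zero, add_zero, hT₀.1 i]
    · ext v
      have hv : α₂ i (δ ((Submodule.span k (Set.range hv₁)).mkQ v)) = 0 :=
        (Submodule.mem_iInf _).1 (δ _).2 i
      have hTv : α₂ i (T₀ v) = α₁ i v := LinearMap.congr_fun (hT₀.2 i) v
      simp only [LinearMap.add_apply, LinearMap.comp_apply, Submodule.subtype_apply, map_add,
        hv, hTv, add_zero]
    · refine Submodule.linearMap_qext _ (LinearMap.ext fun v => Subtype.ext ?_)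
      exact LinearMap.congr_fun (add_left_cancel h) v
    · have hmem : ∀ v, (T - T₀) v ∈ ⨅ i, LinearMap.ker (α₂ i) := fun v =>
        (Submodule.mem_iInf _).2 fun i => by
          have hTv : α₂ i (T v) = α₁ i v := LinearMap.congr_fun (hT.2 i) v
          have hT₀v : α₂ i (T₀ v) = α₁ i v := LinearMap.congr_fun (hT₀.2 i) v
          simp [hTv, hT₀v]
      refine ⟨(Submodule.span k (Set.range hv₁)).liftQ
        ((T - T₀).codRestrict _ hmem) (Submodule.span_le.2 ?_), Set.mem_univ _, ?_⟩
      · rintro _ ⟨i, rfl⟩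
        exact Subtype.ext (by simp [hT.1 i, hT₀.1 i])
      · ext v
        simp
end

section
/- Any two realisations of A of minimal dimension 2|I| − rank(A) are isomorphic: there exists a k-linear isomorphism between them which is a morphism of realisations. -/
open Module

/-- Evaluation against a finite linearly independent family of functionals is surjective. -/
theorem LinearIndependent.surjective_pi {k V I : Type*} [Field k] [AddCommGroup V] [Module k V]
    [Fintype I] {α : I → (V →ₗ[k] k)} (hα : LinearIndependent k α) :
    Function.Surjective (LinearMap.pi α) := by
  classical
  rw [← LinearMap.range_eq_top]
  by_contra h
  obtain ⟨f, hf, hle⟩ := Submodule.exists_le_ker_of_lt_top _ (lt_top_iff_ne_top.mpr h)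
  have hsum : ∑ i, f (Pi.single i 1) • α i = 0 := by
    ext v
    have hv : f (LinearMap.pi α v) = 0 := hle ⟨v, rfl⟩
    rw [← Finset.univ_sum_single (LinearMap.pi α v), map_sum] at hv
    rw [LinearMap.zero_apply, ← hv, LinearMap.sum_apply]
    refine Finset.sum_congr rfl fun i _ ↦ ?_
    rw [LinearMap.smul_apply, LinearMap.pi_apply, smul_eq_mul, mul_comm, ← smul_eq_mul,
      ← map_smul, ← Pi.single_smul, smul_eq_mul, mul_one]
  have hzero := Fintype.linearIndependent_iff.mp hα _ hsum
  exact hf (LinearMap.pi_ext' fun i ↦ LinearMap.ext_ring (by simpa using hzero i))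

/-- If `F` is surjective, `H` is injective and `V` has the least possible dimension,
the kernel of `F` is contained in the range of `H`. -/
theorem LinearMap.ker_le_range_of_finrank_add_eq {k U W V : Type*} [Field k]
    [AddCommGroup U] [Module k U] [FiniteDimensional k U]
    [AddCommGroup W] [Module k W]
    [AddCommGroup V] [Module k V] [FiniteDimensional k V]
    {H : U →ₗ[k] V} {F : V →ₗ[k] W}
    (hH : Function.Injective H) (hF : Function.Surjective F)
    (hdim : finrank k V + finrank k (F ∘ₗ H).range = finrank k U + finrank k W) :
    F.ker ≤ H.range := by
  have hle : (F ∘ₗ H).ker.map H ≤ F.ker := by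
    rintro _ ⟨c, hc, rfl⟩
    exact hc
  have hmap : finrank k ((F ∘ₗ H).ker.map H) = finrank k (F ∘ₗ H).ker :=
    (Submodule.equivMapOfInjective H hH _).finrank_eq.symm
  have hrangeF : finrank k F.range = finrank k W := by
    rw [LinearMap.range_eq_top.mpr hF, finrank_top]
  have hrankF := F.finrank_range_add_finrank_ker
  have hrankFH := (F ∘ₗ H).finrank_range_add_finrank_ker
  rw [← Submodule.eq_of_le_of_finrank_eq hle (by omega)]
  exact LinearMap.map_le_range

/-- Given factorisations `F₁ ∘ H₁ = F₂ ∘ H₂` with `H₁` injective and `F₂` surjective, there is a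
linear map intertwining both. -/
theorem LinearMap.exists_comp_eq_and_comp_eq {k U W V₁ V₂ : Type*} [Field k]
    [AddCommGroup U] [Module k U] [AddCommGroup W] [Module k W]
    [AddCommGroup V₁] [Module k V₁] [AddCommGroup V₂] [Module k V₂]
    {H₁ : U →ₗ[k] V₁} {F₁ : V₁ →ₗ[k] W} {H₂ : U →ₗ[k] V₂} {F₂ : V₂ →ₗ[k] W}
    (hH₁ : Function.Injective H₁) (hF₂ : Function.Surjective F₂)
    (hFH : F₁ ∘ₗ H₁ = F₂ ∘ₗ H₂) :
    ∃ T : V₁ →ₗ[k] V₂, T ∘ₗ H₁ = H₂ ∧ F₂ ∘ₗ T = F₁ := by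
  obtain ⟨L, hL⟩ := H₁.exists_leftInverse_of_injective (LinearMap.ker_eq_bot.mpr hH₁)
  obtain ⟨s, hs⟩ := F₂.exists_rightInverse_of_surjective (LinearMap.range_eq_top.mpr hF₂)
  replace hL u : L (H₁ u) = u := LinearMap.congr_fun hL u
  replace hs w : F₂ (s w) = w := LinearMap.congr_fun hs w
  replace hFH u : F₁ (H₁ u) = F₂ (H₂ u) := LinearMap.congr_fun hFH u
  refine ⟨H₂ ∘ₗ L + s ∘ₗ F₁ ∘ₗ (LinearMap.id - H₁ ∘ₗ L), ?_, ?_⟩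
  · ext u
    simp [hL]
  · ext v
    simp [hs, hFH]

namespace IsRealisation

variable {k I V : Type*} [Field k] [Fintype I] {A : Matrix I I k} [AddCommGroup V] [Module k V]
  {α : I → (V →ₗ[k] k)} {hv : I → V}

theorem pi_comp_linearCombination (h : IsRealisation A V α hv) :
    LinearMap.pi α ∘ₗ Fintype.linearCombination k hv = A.transpose.mulVecLin := by
  ext c i
  simp [Fintype.linearCombination_apply, h.pairing, Matrix.vecMul, dotProduct]

theorem ker_pi_le_range_s12 (h : IsRealisation A V α hv)
    (hmin : finrank k V = 2 * Fintype.card I - A.rank) :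
    (LinearMap.pi α).ker ≤ (Fintype.linearCombination k hv).range := by
  have := h.finite
  refine LinearMap.ker_le_range_of_finrank_add_eq
    h.indep_h.fintypeLinearCombination_injective h.indep_alpha.surjective_pi ?_
  have hrank : finrank k A.transpose.mulVecLin.range = A.rank := A.rank_transpose
  have hcard := A.rank_le_card_width
  rw [h.pi_comp_linearCombination, hrank, hmin, finrank_fintype_fun_eq_card]
  omega

end IsRealisation

/-- Any two realisations of `A` of minimal dimension `2|I| − rank(A)` are isomorphic:
there exists a `k`-linear isomorphism between them which is a morphism of realisations. -/
theorem minimal_realisations_isomorphic {k : Type*} [Field k] [CharZero k] {I : Type*}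
    [Fintype I] (A : Matrix I I k)
    (V₁ : Type*) [AddCommGroup V₁] [Module k V₁]
    (V₂ : Type*) [AddCommGroup V₂] [Module k V₂]
    (α₁ : I → (V₁ →ₗ[k] k)) (hv₁ : I → V₁) (α₂ : I → (V₂ →ₗ[k] k)) (hv₂ : I → V₂)
    (h₁ : IsRealisation A V₁ α₁ hv₁) (h₂ : IsRealisation A V₂ α₂ hv₂)
    (hmin₁ : Module.finrank k V₁ = 2 * Fintype.card I - A.rank)
    (hmin₂ : Module.finrank k V₂ = 2 * Fintype.card I - A.rank) :
    ∃ T : V₁ →ₗ[k] V₂, IsRealisationHom α₁ hv₁ α₂ hv₂ T ∧ Function.Bijective T := by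
  have := h₁.finite
  have := h₂.finite
  have hinj := h₂.indep_h.fintypeLinearCombination_injective
  obtain ⟨T, hTH, hFT⟩ := LinearMap.exists_comp_eq_and_comp_eq
    h₁.indep_h.fintypeLinearCombination_injective h₂.indep_alpha.surjective_pi
    (h₁.pi_comp_linearCombination.trans h₂.pi_comp_linearCombination.symm)
  have hT : Function.Injective T := by
    refine (injective_iff_map_eq_zero T).mpr fun v hv ↦ ?_
    have hker : v ∈ (LinearMap.pi α₁).ker := by
      rw [LinearMap.mem_ker, ← hFT, LinearMap.comp_apply, hv, map_zero]
    obtain ⟨c, rfl⟩ := h₁.ker_pi_le_range_s12 hmin₁ hker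
    rw [← LinearMap.comp_apply, hTH] at hv
    rw [(map_eq_zero_iff _ hinj).mp hv, map_zero]
  refine ⟨T, ⟨fun i ↦ ?_, fun i ↦ ?_⟩, hT,
    (LinearMap.injective_iff_surjective_of_finrank_eq_finrank (hmin₁.trans hmin₂.symm)).mp hT⟩
  · classical
    simpa using LinearMap.congr_fun hTH (Pi.single i 1)
  · ext v
    exact congrFun (LinearMap.congr_fun hFT v) i
end

section
/- Assume A is symmetrisable, with D = diag(d_i) invertible diagonal such that AD is symmetric, and let (V, Π, Π∨) be a realisation of A of minimal dimension 2|I| − rank(A). Then every symmetric k-bilinear form B on V satisfying B(h_i∨, v) = d_i α_i(v) for all i ∈ I and v ∈ V is non-degenerate, and hence is an invariant form. -/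
/-- In a realisation of dimension `2|I| - rank A`, the common kernel of the `α_i` is contained
in the span of the `h_i^∨`. -/
theorem IsRealisation.exists_linearCombination_eq {k : Type*} [Field k] {I : Type*} [Fintype I]
    {A : Matrix I I k} {V : Type*} [AddCommGroup V] [Module k V]
    {α : I → (V →ₗ[k] k)} {hv : I → V} (hreal : IsRealisation A V α hv)
    (hmin : Module.finrank k V = 2 * Fintype.card I - A.rank)
    {v : V} (hαv : ∀ i, α i v = 0) : ∃ c : I → k, ∑ i, c i • hv i = v := by
  have := hreal.finite
  let M : (I → k) →ₗ[k] V := Fintype.linearCombination k hv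
  have hM : Function.Injective M :=
    linearIndependent_iff_injective_fintypeLinearCombination.mp hreal.indep_h
  let Φ : Subspace k (Module.Dual k V) := Submodule.span k (Set.range α)
  let K : Submodule k (I → k) := LinearMap.ker A.vecMulLinear
  have hΦ : Module.finrank k Φ = Fintype.card I := finrank_span_eq_card hreal.indep_alpha
  have hK : A.rank + Module.finrank k K = Fintype.card I := by
    have h := A.vecMulLinear.finrank_range_add_finrank_ker
    rw [Module.finrank_fintype_fun_eq_card] at h
    rw [← h, ← Matrix.rank_transpose A, Matrix.rank, Matrix.mulVecLin_transpose]
  have hmem : ∀ u, (∀ i, α i u = 0) → u ∈ Φ.dualCoannihilator := by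
    intro u hu
    rw [Submodule.mem_dualCoannihilator]
    intro φ hφ
    induction hφ using Submodule.span_induction with
    | mem φ h =>
      obtain ⟨i, rfl⟩ := h
      exact hu i
    | zero => simp
    | add x y _ _ hx hy => simp [hx, hy]
    | smul a x _ hx => simp [hx]
  have hle : K.map M ≤ Φ.dualCoannihilator := by
    rintro _ ⟨c, hc, rfl⟩
    refine hmem _ fun i => ?_
    have hci : (Matrix.vecMul c A) i = 0 := congrFun hc i
    simpa [M, Fintype.linearCombination_apply, hreal.pairing, Matrix.vecMul, dotProduct]
      using hci
  have heq : K.map M = Φ.dualCoannihilator := by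
    apply Submodule.eq_of_le_of_finrank_le hle
    have h := Subspace.finrank_add_finrank_dualCoannihilator_eq Φ
    rw [← (Submodule.equivMapOfInjective M hM K).finrank_eq]
    omega
  have hvmem := hmem v hαv
  rw [← heq] at hvmem
  obtain ⟨c, -, rfl⟩ := hvmem
  exact ⟨c, (Fintype.linearCombination_apply k hv c).symm⟩

/-- Assume `A` is symmetrisable, with `D = diag(d_i)` invertible diagonal such that `AD`
is symmetric, and let `(V, Π, Π∨)` be a realisation of `A` of minimal dimension
`2|I| − rank(A)`.  Then every symmetric `k`-bilinear form `B` on `V` satisfying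
`B(h_i^∨, v) = d_i α_i(v)` for all `i ∈ I` and `v ∈ V` is non-degenerate, and hence is an
invariant form. -/
theorem minimal_invariant_form_nondegenerate {k : Type*} [Field k] [CharZero k]
    {I : Type*} [Fintype I] (A : Matrix I I k)
    (d : I → k) (hd : ∀ i, d i ≠ 0) (hsymm : ∀ i j, A i j * d j = A j i * d i)
    (V : Type*) [AddCommGroup V] [Module k V]
    (α : I → (V →ₗ[k] k)) (hv : I → V) (hreal : IsRealisation A V α hv)
    (hmin : Module.finrank k V = 2 * Fintype.card I - A.rank)
    (B : V →ₗ[k] V →ₗ[k] k)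
    (hBsymm : ∀ x y, B x y = B y x)
    (hBh : ∀ i v, B (hv i) v = d i * α i v) :
    ∀ v, (∀ w, B v w = 0) → v = 0 := by
  intro v hBv
  have hαv : ∀ i, α i v = 0 := fun i => by
    have h := hBh i v
    rw [hBsymm, hBv] at h
    exact (mul_eq_zero.mp h.symm).resolve_left (hd i)
  obtain ⟨c, rfl⟩ := hreal.exists_linearCombination_eq hmin hαv
  have hc : ∀ i, c i * d i = 0 := by
    apply Fintype.linearIndependent_iff.mp hreal.indep_alpha
    ext w
    simpa [hBh, mul_assoc] using hBv w
  exact Finset.sum_eq_zero fun i _ => by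
    rw [(mul_eq_zero.mp (hc i)).resolve_right (hd i), zero_smul]
end

section
/- Assume A is symmetrisable, with D = diag(d_i) invertible diagonal such that AD is symmetric. Then every realisation (V, Π, Π∨) of A possesses an invariant form, i.e. a non-degenerate symmetric bilinear form ⟨·,·⟩ on V with ⟨h_i∨, v⟩ = d_i α_i(v) for all i ∈ I and v ∈ V. -/
/-- A linearly independent family `h` in `V` and a linearly independent family `f` in the dual that
pair symmetrically can be enlarged: for `v` outside the span of `h` there is a functional `g`
outside the span of `f` such that `(v, g)` pairs symmetrically with all `(h i, f i)`. -/
theorem exists_dual_notMem_span_of_symm {k V ι : Type*} [Field k] [AddCommGroup V] [Module k V]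
    [Fintype ι] {h : ι → V} {f : ι → V →ₗ[k] k} (hh : LinearIndependent k h)
    (hs : ∀ i j, f i (h j) = f j (h i)) {v : V} (hv : v ∉ Submodule.span k (Set.range h)) :
    ∃ g : V →ₗ[k] k, (∀ i, g (h i) = f i v) ∧ g ∉ Submodule.span k (Set.range f) := by
  obtain ⟨g₀, hg₀⟩ := LinearMap.exists_extend ((Module.Basis.span hh).constr k fun i => f i v)
  have hg₀h (i : ι) : g₀ (h i) = f i v := by
    have := LinearMap.congr_fun hg₀ (Module.Basis.span hh i)
    rwa [Module.Basis.constr_basis, LinearMap.comp_apply, Submodule.subtype_apply,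
      Module.Basis.span_apply] at this
  by_contra! H
  obtain ⟨c, hc⟩ := (Submodule.mem_span_range_iff_exists_fun k).1 (H g₀ hg₀h)
  have hu : ∑ i, c i • h i ∈ Submodule.span k (Set.range h) :=
    (Submodule.mem_span_range_iff_exists_fun k).2 ⟨c, rfl⟩
  have hvu : v - ∑ i, c i • h i ∉ Submodule.span k (Set.range h) :=
    fun hm => hv (by simpa using add_mem hm hu)
  obtain ⟨g, hg, hgker⟩ := Submodule.exists_le_ker_of_notMem hvu
  have hgh (i : ι) : g (h i) = 0 := hgker (Submodule.subset_span ⟨i, rfl⟩)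
  obtain ⟨e, he⟩ := (Submodule.mem_span_range_iff_exists_fun k).1
    ((Submodule.add_mem_iff_right _ (H g₀ hg₀h)).1 (H (g₀ + g) fun i => by simp [hg₀h, hgh]))
  refine hg ?_
  have hf (i : ι) : f i (v - ∑ j, c j • h j) = 0 := by
    rw [map_sub, ← hg₀h, ← hc]
    simp [hs i]
  rw [← he]
  simp only [LinearMap.sum_apply, LinearMap.smul_apply, hf, smul_zero, Finset.sum_const_zero]

/-- Linearly independent families `h` in `V` and `f` in the dual of `V` that pair symmetrically are
matched by a non-degenerate symmetric bilinear form. -/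
theorem exists_nondegenerate_symm_form_of_linearIndependent {k V ι : Type*} [Field k]
    [AddCommGroup V] [Module k V] [FiniteDimensional k V] [Fintype ι] {h : ι → V}
    {f : ι → V →ₗ[k] k} (hh : LinearIndependent k h) (hf : LinearIndependent k f)
    (hs : ∀ i j, f i (h j) = f j (h i)) :
    ∃ B : V →ₗ[k] V →ₗ[k] k, (∀ x y, B x y = B y x) ∧ Function.Injective B ∧
      ∀ i, B (h i) = f i := by
  obtain ⟨n, hn⟩ := Nat.exists_eq_add_of_le hh.fintype_card_le_finrank
  induction n generalizing ι with
  | zero =>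
    have hspan := (hh.span_eq_top_of_card_eq_finrank' (by omega)).ge
    let b := Module.Basis.mk hh hspan
    have hb (i : ι) : b i = h i := Module.Basis.mk_apply hh hspan i
    have hB (i : ι) : b.constr k f (h i) = f i := by rw [← hb, b.constr_basis]
    refine ⟨b.constr k f, fun x y => ?_, ?_, hB⟩
    · have : b.constr k f = (b.constr k f).flip :=
        b.ext fun i => b.ext fun j => by simp [hb, hB, hs i j]
      exact LinearMap.congr_fun₂ this x y
    · refine (injective_iff_map_eq_zero _).2 fun x hx => b.equivFun.map_eq_zero_iff.1 (funext ?_)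
      rw [b.constr_apply_fintype k] at hx
      exact Fintype.linearIndependent_iff.1 hf _ hx
  | succ n ih =>
    have : Submodule.span k (Set.range h) ≠ ⊤ := fun htop => by
      have := finrank_span_eq_card hh
      rw [htop, finrank_top] at this
      omega
    obtain ⟨v, -, hv⟩ := SetLike.exists_of_lt (lt_top_iff_ne_top.2 this)
    obtain ⟨g, hg, hgf⟩ := exists_dual_notMem_span_of_symm hh hs hv
    obtain ⟨B, hsymm, hinj, hB⟩ := ih (ι := Option ι) (h := fun o => o.casesOn' v h)
      (f := fun o => o.casesOn' g f) (hh.option hv) (hf.option hgf)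
      (by rintro (_ | i) (_ | j) <;> simp [hg, hs]) (by rw [Fintype.card_option]; omega)
    exact ⟨B, hsymm, hinj, fun i => hB (some i)⟩


/-- Assume `A` is symmetrisable, with `D = diag(d_i)` invertible diagonal such that `AD`
is symmetric.  Then every realisation `(V, Π, Π∨)` of `A` possesses an invariant form,
i.e. a non-degenerate symmetric bilinear form `⟨·,·⟩` on `V` with
`⟨h_i^∨, v⟩ = d_i α_i(v)` for all `i ∈ I` and `v ∈ V`. -/
theorem exists_invariant_form {k : Type*} [Field k] [CharZero k]
    {I : Type*} [Fintype I] (A : Matrix I I k)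
    (d : I → k) (hd : ∀ i, d i ≠ 0) (hsymm : ∀ i j, A i j * d j = A j i * d i)
    (V : Type*) [AddCommGroup V] [Module k V]
    (α : I → (V →ₗ[k] k)) (hv : I → V) (hreal : IsRealisation A V α hv) :
    ∃ B : V →ₗ[k] V →ₗ[k] k,
      (∀ x y, B x y = B y x) ∧
      (∀ v, (∀ w, B v w = 0) → v = 0) ∧
      ∀ i v, B (hv i) v = d i * α i v := by
  have := hreal.finite
  obtain ⟨B, hsym, hinj, hB⟩ := exists_nondegenerate_symm_form_of_linearIndependent
    (f := fun i => d i • α i) hreal.indep_h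
    (hreal.indep_alpha.units_smul fun i => Units.mk0 (d i) (hd i)) fun i j => by
      simp only [LinearMap.smul_apply, hreal.pairing, smul_eq_mul]
      linear_combination -hsymm i j
  refine ⟨B, hsym, fun v hv0 => hinj ?_, fun i v => ?_⟩
  · rw [map_zero]
    exact LinearMap.ext hv0
  · rw [hB, LinearMap.smul_apply, smul_eq_mul]
end

section
/- Let (V, Π, Π∨) be a realisation of A and h̄ the canonical realisation of A. If p ∈ Hom_A(h̄, V), then p(Λ∨) is a subspace of V complementary to Π⊥. Moreover, the map p ↦ p(Λ∨) is a bijection from Hom_A(h̄, V) onto the set of subspaces Ṽ ⊆ V with Π⊥ ⊕ Ṽ = V. -/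
/-- The underlying `2|I|`-dimensional space `h̄ = (I → k) × (I → k)` of the canonical
realisation of `A`. -/
abbrev Hbar (k I : Type*) := (I → k) × (I → k)

/-- The coroots `h_i^∨` of the canonical realisation: the first `|I|` standard basis
vectors of `h̄`. -/
def hbarH {k I : Type*} [Semiring k] [DecidableEq I] (i : I) : Hbar k I :=
  (Pi.single i 1, 0)

/-- The elements `λ_i^∨` of the canonical realisation: the last `|I|` standard basis
vectors of `h̄`. -/
def hbarL {k I : Type*} [Semiring k] [DecidableEq I] (i : I) : Hbar k I :=
  (0, Pi.single i 1)

/-- The simple roots `α_i` of the canonical realisation, determined by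
`α_i (h_j^∨) = a_{ji}` and `α_i (λ_j^∨) = δ_{ij}`. -/
noncomputable def hbarAlpha {k : Type*} [Field k] {I : Type*} [Fintype I]
    (A : Matrix I I k) (i : I) : Hbar k I →ₗ[k] k :=
  (LinearMap.proj i).comp (LinearMap.snd k (I → k) (I → k)) +
    ∑ j, A j i • ((LinearMap.proj j).comp (LinearMap.fst k (I → k) (I → k)))

/-- `Λ∨ ⊆ h̄`: the span of the `λ_i^∨`. -/
noncomputable def LambdaVee (k I : Type*) [Field k] [DecidableEq I] :
    Submodule k (Hbar k I) :=
  Submodule.span k (Set.range (hbarL (k := k) (I := I)))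

theorem LinearMap.pi_surjective_of_linearIndependent {k V I : Type*} [Field k] [AddCommGroup V]
    [Module k V] [Finite I] {α : I → (V →ₗ[k] k)} (h : LinearIndependent k α) :
    Function.Surjective (LinearMap.pi α) := by
  classical
  have := Fintype.ofFinite I
  rw [← LinearMap.dualMap_injective_iff, ← LinearMap.ker_eq_bot, LinearMap.ker_eq_bot']
  intro φ hφ
  have hsum : ∑ i, φ (Pi.single i 1) • α i = 0 := by
    ext v
    have hv := LinearMap.congr_fun hφ v
    rw [LinearMap.dualMap_apply, LinearMap.pi_apply_eq_sum_univ φ] at hv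
    have hsingle (i : I) : (fun j => if i = j then (1 : k) else 0) = Pi.single i 1 := by
      ext j
      simp [Pi.single_apply, eq_comm]
    simpa [mul_comm, hsingle] using hv
  have hzero := Fintype.linearIndependent_iff.1 h _ hsum
  ext i
  simpa using hzero i

theorem LinearMap.isCompl_ker_range_of_comp_eq_id {k V U : Type*} [Field k] [AddCommGroup V]
    [Module k V] [AddCommGroup U] [Module k U] {f : V →ₗ[k] U} {s : U →ₗ[k] V}
    (h : f ∘ₗ s = LinearMap.id) : IsCompl (LinearMap.ker f) (LinearMap.range s) := by
  have h' (x : U) : f (s x) = x := LinearMap.congr_fun h x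
  constructor
  · rw [Submodule.disjoint_def]
    rintro _ hx ⟨y, rfl⟩
    rw [LinearMap.mem_ker, h'] at hx
    simp [hx]
  · rw [codisjoint_iff, Submodule.eq_top_iff']
    intro v
    exact Submodule.mem_sup.2 ⟨v - s (f v), by simp [h'], s (f v), ⟨f v, rfl⟩, by simp⟩

theorem LinearMap.exists_section_range_eq {k V U : Type*} [Field k] [AddCommGroup V]
    [Module k V] [AddCommGroup U] [Module k U] {f : V →ₗ[k] U} (hf : Function.Surjective f)
    {W : Submodule k V} (hW : IsCompl (LinearMap.ker f) W) :
    ∃ s : U →ₗ[k] V, f ∘ₗ s = LinearMap.id ∧ LinearMap.range s = W := by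
  have hbij : Function.Bijective (f.domRestrict W) := by
    constructor
    · rw [← LinearMap.ker_eq_bot, LinearMap.ker_eq_bot']
      intro w hw
      exact Subtype.ext (Submodule.disjoint_def.1 hW.disjoint w hw w.2)
    · intro u
      obtain ⟨v, rfl⟩ := hf u
      obtain ⟨x, hx, w, hw, rfl⟩ :=
        Submodule.mem_sup.1 (hW.sup_eq_top ▸ Submodule.mem_top : v ∈ LinearMap.ker f ⊔ W)
      exact ⟨⟨w, hw⟩, by simp [LinearMap.mem_ker.1 hx]⟩
  let e := LinearEquiv.ofBijective (f.domRestrict W) hbij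
  refine ⟨W.subtype ∘ₗ e.symm.toLinearMap, LinearMap.ext fun u => e.apply_symm_apply u, ?_⟩
  rw [LinearMap.range_comp_of_range_eq_top _ (LinearEquiv.range _), Submodule.range_subtype]

/-- Two sections of `f` with the same range coincide. -/
theorem LinearMap.section_eq_of_range_eq {k V U : Type*} [Field k] [AddCommGroup V]
    [Module k V] [AddCommGroup U] [Module k U] {f : V →ₗ[k] U} {s t : U →ₗ[k] V}
    (hs : f ∘ₗ s = LinearMap.id) (ht : f ∘ₗ t = LinearMap.id)
    (h : LinearMap.range s = LinearMap.range t) : s = t := by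
  ext x
  obtain ⟨y, hy⟩ : s x ∈ LinearMap.range t := h ▸ LinearMap.mem_range_self s x
  have hyx : y = x := by
    have := congrArg f hy
    rwa [← LinearMap.comp_apply, ← LinearMap.comp_apply, hs, ht] at this
  rw [← hy, hyx]

theorem lambdaVee_eq_range_inr (k I : Type*) [Field k] [Finite I] [DecidableEq I] :
    LambdaVee k I = LinearMap.range (LinearMap.inr k (I → k) (I → k)) := by
  have h : (hbarL : I → Hbar k I) =
      LinearMap.inr k (I → k) (I → k) ∘ fun i => Pi.single i 1 := rfl
  have hspan : Submodule.span k (Set.range fun i : I => (Pi.single i 1 : I → k)) = ⊤ := by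
    rw [← (Pi.basisFun k I).span_eq]
    exact congrArg _ (congrArg _ (funext fun i => (Pi.basisFun_apply k I i).symm))
  rw [LambdaVee, h, Set.range_comp, Submodule.span_image, hspan, Submodule.map_top]

theorem map_lambdaVee {k I V : Type*} [Field k] [Finite I] [DecidableEq I] [AddCommGroup V]
    [Module k V] (p : Hbar k I →ₗ[k] V) :
    (LambdaVee k I).map p = LinearMap.range (p ∘ₗ LinearMap.inr k (I → k) (I → k)) := by
  rw [lambdaVee_eq_range_inr, LinearMap.range_comp]

/-- A linear map out of the canonical realisation is a morphism exactly when it is given by the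
coroots on the first factor and by a section of `v ↦ (α i v)_i` on the second. -/
theorem isRealisationHom_hbar_iff {k I V : Type*} [Field k] [Fintype I] [DecidableEq I]
    [AddCommGroup V] [Module k V] {A : Matrix I I k} {α : I → (V →ₗ[k] k)} {hv : I → V}
    (hpair : ∀ i j, α i (hv j) = A j i) (p : Hbar k I →ₗ[k] V) :
    IsRealisationHom (hbarAlpha A) hbarH α hv p ↔
      p ∘ₗ LinearMap.inl k (I → k) (I → k) = Fintype.linearCombination k hv ∧
      LinearMap.pi α ∘ₗ p ∘ₗ LinearMap.inr k (I → k) (I → k) = LinearMap.id := by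
  have hinl : (∀ i, p (hbarH i) = hv i) ↔
      p ∘ₗ LinearMap.inl k (I → k) (I → k) = Fintype.linearCombination k hv := by
    constructor
    · intro h
      ext i
      simpa [hbarH] using h i
    · intro h i
      simpa [hbarH] using LinearMap.congr_fun h (Pi.single i 1)
  rw [IsRealisationHom, hinl]
  refine and_congr_right fun hp => ⟨fun h => ?_, fun h i => ?_⟩
  · refine LinearMap.ext fun x => funext fun i => ?_
    simpa [hbarAlpha] using LinearMap.congr_fun (h i) (0, x)
  · refine LinearMap.prod_ext ?_ ?_
    · rw [LinearMap.comp_assoc, hp]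
      refine LinearMap.ext fun x => ?_
      simp [hbarAlpha, Fintype.linearCombination_apply, hpair, mul_comm]
    · refine LinearMap.ext fun x => ?_
      simpa [hbarAlpha] using congrFun (LinearMap.congr_fun h x) i

/-- Let `(V, Π, Π∨)` be a realisation of `A` and `h̄` the canonical realisation of `A`.
If `p ∈ Hom_A(h̄, V)` then `p(Λ∨)` is a subspace of `V` complementary to `Π⊥`; moreover
`p ↦ p(Λ∨)` is a bijection from `Hom_A(h̄, V)` onto the set of subspaces `Ṽ ⊆ V` with
`Π⊥ ⊕ Ṽ = V`. -/
theorem canonical_proj_bijOn {k : Type*} [Field k] [CharZero k] {I : Type*} [Fintype I]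
    [DecidableEq I] (A : Matrix I I k)
    (V : Type*) [AddCommGroup V] [Module k V]
    (α : I → (V →ₗ[k] k)) (hv : I → V) (hreal : IsRealisation A V α hv) :
    (∀ p : Hbar k I →ₗ[k] V, IsRealisationHom (hbarAlpha A) hbarH α hv p →
        IsCompl (⨅ i, LinearMap.ker (α i)) ((LambdaVee k I).map p)) ∧
    Set.BijOn (fun p : Hbar k I →ₗ[k] V => (LambdaVee k I).map p)
      {p | IsRealisationHom (hbarAlpha A) hbarH α hv p}
      {W : Submodule k V | IsCompl (⨅ i, LinearMap.ker (α i)) W} := by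
  simp only [← LinearMap.ker_pi, map_lambdaVee, isRealisationHom_hbar_iff hreal.pairing]
  have hcompl (p : Hbar k I →ₗ[k] V)
      (hp : p ∘ₗ LinearMap.inl k (I → k) (I → k) = Fintype.linearCombination k hv ∧
        LinearMap.pi α ∘ₗ p ∘ₗ LinearMap.inr k (I → k) (I → k) = LinearMap.id) :=
    LinearMap.isCompl_ker_range_of_comp_eq_id hp.2
  refine ⟨hcompl, hcompl, fun p hp q hq hpq => ?_, fun W hW => ?_⟩
  · exact LinearMap.prod_ext (hp.1.trans hq.1.symm)
      (LinearMap.section_eq_of_range_eq hp.2 hq.2 hpq)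
  · obtain ⟨s, hs, hsW⟩ := LinearMap.exists_section_range_eq
      (LinearMap.pi_surjective_of_linearIndependent hreal.indep_alpha) hW
    exact ⟨(Fintype.linearCombination k hv).coprod s,
      ⟨LinearMap.coprod_inl .., by rw [LinearMap.coprod_inr, hs]⟩,
      by simpa only [LinearMap.coprod_inr] using hsW⟩
end

section
/- Let (V, Π, Π∨) be a realisation of A and h̄ the canonical realisation of A. If ι ∈ Hom_A(V, h̄), then ι⁻¹(Λ∨) is a subspace of V complementary to V'. Moreover, the map ι ↦ ι⁻¹(Λ∨) is a bijection from Hom_A(V, h̄) onto the set of subspaces V'' ⊆ V with V' ⊕ V'' = V. -/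
section

variable {k : Type*} [Field k] {I : Type*}

theorem hbarAlpha_apply [Fintype I] (A : Matrix I I k) (i : I) (x : Hbar k I) :
    hbarAlpha A i x = x.2 i + ∑ j, A j i * x.1 j := by
  simp [hbarAlpha]

theorem mem_LambdaVee [Finite I] [DecidableEq I] {x : Hbar k I} :
    x ∈ LambdaVee k I ↔ x.1 = 0 := by
  have := Fintype.ofFinite I
  constructor
  · intro hx
    have hle : LambdaVee k I ≤ LinearMap.ker (LinearMap.fst k (I → k) (I → k)) := by
      refine Submodule.span_le.2 ?_
      rintro _ ⟨i, rfl⟩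
      simp [hbarL]
    simpa using hle hx
  · intro hx
    have hsum : x = ∑ i, x.2 i • (hbarL i : Hbar k I) := by
      ext j
      · simp [Prod.fst_sum, hbarL, hx]
      · simp [Prod.snd_sum, hbarL, Finset.sum_apply, Pi.single_apply]
    rw [hsum]
    exact Submodule.sum_mem _ fun i _ =>
      Submodule.smul_mem _ _ (Submodule.subset_span ⟨i, rfl⟩)

variable {V : Type*} [AddCommGroup V] [Module k V]

/-- A vector of the canonical realisation is determined by its first component and the values of
the simple roots on it. -/
theorem IsRealisationHom.apply_eq_of_fst_eq [Fintype I] [DecidableEq I] {A : Matrix I I k}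
    {α : I → (V →ₗ[k] k)} {hv : I → V} {ι₁ ι₂ : V →ₗ[k] Hbar k I}
    (h₁ : IsRealisationHom α hv (hbarAlpha A) hbarH ι₁)
    (h₂ : IsRealisationHom α hv (hbarAlpha A) hbarH ι₂) {v : V}
    (hfst : (ι₁ v).1 = (ι₂ v).1) : ι₁ v = ι₂ v := by
  refine Prod.ext hfst (funext fun i => ?_)
  have e : hbarAlpha A i (ι₁ v) = hbarAlpha A i (ι₂ v) :=
    LinearMap.congr_fun ((h₁.2 i).trans (h₂.2 i).symm) v
  simpa only [hbarAlpha_apply, hfst, add_left_inj] using e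

/-- If `f` sends a finite family `b` to the standard basis, then `ker f` is a complement of the
span of `b`. -/
theorem isCompl_span_ker_of_apply_eq_single [Finite I] [DecidableEq I] {b : I → V}
    {f : V →ₗ[k] (I → k)} (hf : ∀ i, f (b i) = Pi.single i 1) :
    IsCompl (Submodule.span k (Set.range b)) (LinearMap.ker f) := by
  have := Fintype.ofFinite I
  have hfs (c : I → k) : f (∑ i, c i • b i) = c := by
    ext j
    simp [hf, Finset.sum_apply, Pi.single_apply]
  constructor
  · rw [Submodule.disjoint_def]
    intro x hx hfx
    obtain ⟨c, rfl⟩ := (Submodule.mem_span_range_iff_exists_fun k).1 hx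
    rw [LinearMap.mem_ker, hfs] at hfx
    simp [hfx]
  · rw [codisjoint_iff_le_sup]
    intro x _
    refine Submodule.mem_sup.2 ⟨∑ i, f x i • b i, ?_, x - ∑ i, f x i • b i, ?_,
      add_sub_cancel _ _⟩
    · exact (Submodule.mem_span_range_iff_exists_fun k).2 ⟨f x, rfl⟩
    · rw [LinearMap.mem_ker, map_sub, hfs, sub_self]

theorem comap_LambdaVee [Finite I] [DecidableEq I] (ι : V →ₗ[k] Hbar k I) :
    (LambdaVee k I).comap ι = LinearMap.ker (LinearMap.fst k (I → k) (I → k) ∘ₗ ι) := by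
  ext v
  simp [mem_LambdaVee]

theorem IsRealisationHom.isCompl_comap_LambdaVee [Fintype I] [DecidableEq I] {A : Matrix I I k}
    {α : I → (V →ₗ[k] k)} {hv : I → V} {ι : V →ₗ[k] Hbar k I}
    (h : IsRealisationHom α hv (hbarAlpha A) hbarH ι) :
    IsCompl (Submodule.span k (Set.range hv)) ((LambdaVee k I).comap ι) := by
  rw [comap_LambdaVee]
  exact isCompl_span_ker_of_apply_eq_single fun i => by simp [h.1 i, hbarH]

/-- Along any complement `W` of the span of a linearly independent family `b`, there is a linear
map with kernel `W` sending `b` to the standard basis. -/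
theorem exists_ker_eq_of_isCompl_span [Finite I] [DecidableEq I] {b : I → V}
    (hb : LinearIndependent k b) {W : Submodule k V}
    (hW : IsCompl (Submodule.span k (Set.range b)) W) :
    ∃ f : V →ₗ[k] (I → k), (∀ i, f (b i) = Pi.single i 1) ∧ LinearMap.ker f = W := by
  let e := (Module.Basis.span hb).equivFun
  refine ⟨e.toLinearMap ∘ₗ Submodule.projectionOnto _ W hW, fun i => ?_, ?_⟩
  · have hbi : b i = (Module.Basis.span hb i : V) := by simp
    rw [LinearMap.comp_apply, hbi, Submodule.projectionOnto_apply_left]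
    ext j
    simp [e, Pi.single_apply, Finsupp.single_apply, eq_comm]
  · rw [LinearEquiv.ker_comp, Submodule.ker_projectionOnto]

/-- A linear map sending the coroots to the standard basis extends to a morphism into the canonical
realisation of which it is the first component. -/
theorem IsRealisation.exists_hom_fst_comp_eq [Fintype I] [DecidableEq I] {A : Matrix I I k}
    {α : I → (V →ₗ[k] k)} {hv : I → V} (hreal : IsRealisation A V α hv) {f : V →ₗ[k] (I → k)}
    (hf : ∀ i, f (hv i) = Pi.single i 1) :
    ∃ ι : V →ₗ[k] Hbar k I, IsRealisationHom α hv (hbarAlpha A) hbarH ι ∧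
      LinearMap.fst k (I → k) (I → k) ∘ₗ ι = f := by
  refine ⟨f.prod (LinearMap.pi α - A.transpose.mulVecLin ∘ₗ f), ⟨fun i => ?_, fun i => ?_⟩,
    LinearMap.fst_prod _ _⟩
  · refine Prod.ext (hf i) (funext fun j => ?_)
    simp [hbarH, hf, hreal.pairing]
  · ext v
    simp [hbarAlpha_apply, Matrix.vecMul, dotProduct, mul_comm]

end

/-- Let `(V, Π, Π∨)` be a realisation of `A` and `h̄` the canonical realisation of `A`.
If `ι ∈ Hom_A(V, h̄)` then `ι⁻¹(Λ∨)` is a subspace of `V` complementary to `V'` (the span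
of the `h_i^∨`); moreover `ι ↦ ι⁻¹(Λ∨)` is a bijection from `Hom_A(V, h̄)` onto the set
of subspaces `V'' ⊆ V` with `V' ⊕ V'' = V`. -/
theorem canonical_incl_bijOn {k : Type*} [Field k] [CharZero k] {I : Type*} [Fintype I]
    [DecidableEq I] (A : Matrix I I k)
    (V : Type*) [AddCommGroup V] [Module k V]
    (α : I → (V →ₗ[k] k)) (hv : I → V) (hreal : IsRealisation A V α hv) :
    (∀ ι : V →ₗ[k] Hbar k I, IsRealisationHom α hv (hbarAlpha A) hbarH ι →
        IsCompl (Submodule.span k (Set.range hv)) ((LambdaVee k I).comap ι)) ∧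
    Set.BijOn (fun ι : V →ₗ[k] Hbar k I => (LambdaVee k I).comap ι)
      {ι | IsRealisationHom α hv (hbarAlpha A) hbarH ι}
      {W : Submodule k V | IsCompl (Submodule.span k (Set.range hv)) W} := by
  refine ⟨fun ι h => h.isCompl_comap_LambdaVee, fun ι h => h.isCompl_comap_LambdaVee, ?_, ?_⟩
  · intro ι₁ h₁ ι₂ h₂ heq
    refine LinearMap.ext_on_codisjoint h₁.isCompl_comap_LambdaVee.codisjoint
      (LinearMap.eqOn_span ?_) fun v hv₁ => h₁.apply_eq_of_fst_eq h₂ ?_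
    · rintro _ ⟨i, rfl⟩
      rw [h₁.1, h₂.1]
    · have hv₂ : v ∈ (LambdaVee k I).comap ι₂ := (SetLike.ext_iff.1 heq v).1 hv₁
      exact (mem_LambdaVee.1 hv₁).trans (mem_LambdaVee.1 hv₂).symm
  · intro W hW
    obtain ⟨f, hf, hker⟩ := exists_ker_eq_of_isCompl_span hreal.indep_h hW
    obtain ⟨ι, hι, hfst⟩ := hreal.exists_hom_fst_comp_eq hf
    exact ⟨ι, hι, (comap_LambdaVee ι).trans (hfst ▸ hker)⟩
end

section
/- Let (V, Π, Π∨) be a realisation of A and h̄ the canonical realisation of A. Let ι ∈ Hom_A(V, h̄) and p ∈ Hom_A(h̄, V), and set V'' = ι⁻¹(Λ∨) and Ṽ = p(Λ∨). Then p ∘ ι = id_V if and only if V'' ⊆ Ṽ. -/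
theorem mem_LambdaVee_iff {k I : Type*} [Field k] [Fintype I] [DecidableEq I]
    {x : Hbar k I} : x ∈ LambdaVee k I ↔ x.1 = 0 := by
  have hrange : Set.range (hbarL (k := k) (I := I)) =
      LinearMap.inr k (I → k) (I → k) '' Set.range fun i => Pi.single i 1 := by
    rw [← Set.range_comp]
    rfl
  have hspan : Submodule.span k (Set.range fun i : I => (Pi.single i 1 : I → k)) = ⊤ := by
    simpa only [← Pi.basisFun_apply] using (Pi.basisFun k I).span_eq
  rw [LambdaVee, hrange, ← Submodule.map_span, hspan, Submodule.map_top, LinearMap.range_inr,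
    LinearMap.mem_ker, LinearMap.fst_apply]

theorem hbarAlpha_apply_of_fst_eq_zero {k : Type*} [Field k] {I : Type*} [Fintype I]
    (A : Matrix I I k) (i : I) {x : Hbar k I} (hx : x.1 = 0) :
    hbarAlpha A i x = x.2 i := by
  simp [hbarAlpha, hx]

/-- Let `(V, Π, Π∨)` be a realisation of `A` and `h̄` the canonical realisation of `A`.
Let `ι ∈ Hom_A(V, h̄)` and `p ∈ Hom_A(h̄, V)`, and set `V'' = ι⁻¹(Λ∨)` and `Ṽ = p(Λ∨)`.
Then `p ∘ ι = id_V` if and only if `V'' ⊆ Ṽ`. -/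
theorem canonical_retraction_iff {k : Type*} [Field k] [CharZero k] {I : Type*}
    [Fintype I] [DecidableEq I] (A : Matrix I I k)
    (V : Type*) [AddCommGroup V] [Module k V]
    (α : I → (V →ₗ[k] k)) (hv : I → V) (hreal : IsRealisation A V α hv)
    (ι : V →ₗ[k] Hbar k I) (p : Hbar k I →ₗ[k] V)
    (hι : IsRealisationHom α hv (hbarAlpha A) hbarH ι)
    (hp : IsRealisationHom (hbarAlpha A) hbarH α hv p) :
    p ∘ₗ ι = LinearMap.id ↔ (LambdaVee k I).comap ι ≤ (LambdaVee k I).map p := by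
  constructor
  · intro h v hmem
    exact ⟨ι v, hmem, LinearMap.congr_fun h v⟩
  · intro hle
    have hfix : ∀ v, (ι v).1 = 0 → p (ι v) = v := by
      intro v hv0
      obtain ⟨x, hx, rfl⟩ := hle (mem_LambdaVee_iff.2 hv0)
      have hx0 := mem_LambdaVee_iff.1 hx
      suffices ι (p x) = x by rw [this]
      refine Prod.ext (hv0.trans hx0.symm) (funext fun i => ?_)
      rw [← hbarAlpha_apply_of_fst_eq_zero A i hv0, ← hbarAlpha_apply_of_fst_eq_zero A i hx0]
      exact (LinearMap.congr_fun (hι.2 i) (p x)).trans (LinearMap.congr_fun (hp.2 i) x)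
    ext v
    let w := ∑ j, (ι v).1 j • hv j
    have hw : p (ι w) = w := by simp [w, hι.1, hp.1]
    have hvw : p (ι (v - w)) = v - w := by
      apply hfix
      ext i
      simp [w, hι.1, hbarH, Prod.fst_sum, Finset.sum_apply, Pi.single_apply]
    rw [map_sub, map_sub, hw] at hvw
    exact sub_left_inj.1 hvw
end

section
/- Let A be an I×I matrix over k, and let D be its diagram: the simple graph with vertex set I and an edge between distinct i, j unless a_{ij} = a_{ji} = 0. Assume det(A_B) ≠ 0 for every subdiagram B ⊆ D with |I ∖ B| ≥ 2, where A_B = (a_{ij})_{i,j∈B}. Let (h, Π, Π∨) be a realisation of A of minimal dimension 2|I| − rank(A). Then there exists a family of subspaces h_B ⊆ h, indexed by the subdiagrams B ⊆ D, with h_D = h, such that for every B: (a) the span of {h_i∨ : i ∈ B} is contained in h_B; (b) the restrictions of the linear forms {α_i}_{i∈B} to h_B are linearly independent; (c) dim h_B = 2|B| − rank(A_B); and for all subdiagrams B, B' ⊆ D: (d) h_{B'} ⊆ h_B whenever B' ⊆ B; (e) if B and B' are orthogonal (disjoint with no edge of D between them), then h_B ⊆ ∩_{i∈B'} ker α_i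 and h_{B'} ⊆ ∩_{i∈B} ker α_i. -/
/-- A finite linearly independent family of linear forms can take arbitrary prescribed values. -/
theorem LinearIndependent.pi_surjective {k ι V : Type*} [Field k] [Finite ι]
    [AddCommGroup V] [Module k V] {α : ι → (V →ₗ[k] k)} (hα : LinearIndependent k α) :
    Function.Surjective (LinearMap.pi α) := by
  have hfun : LinearIndependent k (fun i v => α i v) :=
    hα.map' (LinearMap.ltoFun k V k k) (LinearMap.ker_eq_bot.mpr DFunLike.coe_injective)
  rw [← LinearMap.range_eq_top, eq_top_iff, ← span_flip_eq_top_iff_linearIndependent.mpr hfun,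
    Submodule.span_le]
  rintro _ ⟨v, rfl⟩
  exact ⟨v, rfl⟩

/-- Linear forms whose restrictions to a subspace `W` take all possible values on `W` are
linearly independent on `W`. -/
theorem linearIndependent_domRestrict_of_forall_exists {k ι V : Type*} [Field k] [Finite ι]
    [AddCommGroup V] [Module k V] {α : ι → (V →ₗ[k] k)} {W : Submodule k V}
    (h : ∀ c : ι → k, ∃ w ∈ W, ∀ i, α i w = c i) :
    LinearIndependent k (fun i => (α i).domRestrict W) := by
  classical
  have := Fintype.ofFinite ι
  rw [Fintype.linearIndependent_iff]
  intro g hg i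
  obtain ⟨w, hw, hwi⟩ := h (Pi.single i 1)
  have := LinearMap.congr_fun hg ⟨w, hw⟩
  simpa [hwi, Pi.single_apply] using this

/-- Inside a realisation of `A`, the diagonal submatrix indexed by `B` has a minimal realisation
on which every `α_j` with `j` orthogonal to `B` vanishes. -/
theorem IsRealisation.exists_submodule {k I V : Type*} [Field k] [Fintype I]
    {A : Matrix I I k} [AddCommGroup V] [Module k V] {α : I → (V →ₗ[k] k)} {hv : I → V}
    (hreal : IsRealisation A V α hv) (B : Finset I) :
    ∃ W : Submodule k V,
      (∀ i ∈ B, hv i ∈ W) ∧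
      LinearIndependent k (fun i : B => (α i).domRestrict W) ∧
      Module.finrank k W =
        2 * B.card - (A.submatrix (fun b : B => (b : I)) (fun b : B => (b : I))).rank ∧
      ∀ j ∉ B, (∀ i ∈ B, A i j = 0) → W ≤ LinearMap.ker (α j) := by
  have := hreal.finite
  obtain ⟨s, hs⟩ := (LinearMap.pi α).exists_rightInverse_of_surjective
    (LinearMap.range_eq_top.mpr hreal.indep_alpha.pi_surjective)
  set M := A.submatrix (fun b : B => (b : I)) (fun b : B => (b : I))
  let t : (B → k) →ₗ[k] V := s ∘ₗ Function.ExtendByZero.linearMap k (Subtype.val : B → I)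
  have hs_apply (c : I → k) (i : I) : α i (s c) = c i := congr_fun (LinearMap.congr_fun hs c) i
  have ht_mem (c : B → k) (i : B) : α i (t c) = c i :=
    (hs_apply _ _).trans (Subtype.val_injective.extend_apply c 0 i)
  have ht_notMem (c : B → k) (j : I) (hj : j ∉ B) : α j (t c) = 0 :=
    (hs_apply _ _).trans (Function.extend_apply' (f := Subtype.val) c (0 : I → k) j (by
      rintro ⟨⟨i, hi⟩, rfl⟩
      exact hj hi))
  let φ : V →ₗ[k] (B → k) := LinearMap.pi fun i : B => α i
  have hφt (c : B → k) : φ (t c) = c := funext (ht_mem c)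
  have ht_inj : Function.Injective t := Function.LeftInverse.injective hφt
  let S := Submodule.span k (Set.range fun b : B => hv b)
  have hφS : S.map φ = Submodule.span k (Set.range M.row) := by
    rw [Submodule.map_span, ← Set.range_comp]
    congr 2
    ext j i
    exact hreal.pairing i j
  obtain ⟨C, hC⟩ := (S.map φ).exists_isCompl
  have hdisj : Disjoint S (C.map t) := by
    rw [Submodule.disjoint_def]
    rintro _ hx ⟨c, hc, rfl⟩
    have : c = 0 := by
      refine Submodule.disjoint_def.mp hC.disjoint c ?_ hc
      exact ⟨t c, hx, hφt c⟩
    rw [this, map_zero]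
  refine ⟨S ⊔ C.map t, fun i hi => ?_, ?_, ?_, fun j hj hA => ?_⟩
  · exact Submodule.mem_sup_left (Submodule.subset_span ⟨⟨i, hi⟩, rfl⟩)
  · refine linearIndependent_domRestrict_of_forall_exists fun c => ?_
    obtain ⟨_, ⟨x, hx, rfl⟩, y, hy, rfl⟩ :=
      Submodule.mem_sup.mp (hC.sup_eq_top ▸ Submodule.mem_top : c ∈ S.map φ ⊔ C)
    refine ⟨x + t y, Submodule.add_mem_sup hx ⟨y, hy, rfl⟩, fun i => ?_⟩
    rw [map_add, ht_mem]
    rfl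
  · have hSC := Submodule.finrank_sup_add_finrank_inf_eq S (C.map t)
    have hS : Module.finrank k S = B.card :=
      (finrank_span_eq_card (hreal.indep_h.comp _ Subtype.val_injective)).trans (by simp)
    have hCt : Module.finrank k (C.map t) = Module.finrank k C :=
      (Submodule.equivMapOfInjective t ht_inj C).finrank_eq.symm
    have hsum := Submodule.finrank_add_eq_of_isCompl hC
    rw [hφS, ← Matrix.rank_eq_finrank_span_row, Module.finrank_fintype_fun_eq_card,
      Fintype.card_coe] at hsum
    rw [hdisj.eq_bot, finrank_bot] at hSC
    omega
  · refine sup_le (Submodule.span_le.mpr ?_) ?_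
    · rintro _ ⟨i, rfl⟩
      exact (hreal.pairing j i).trans (hA i i.2)
    · rintro _ ⟨c, -, rfl⟩
      exact ht_notMem c j hj

/-- Let `A` be an `I×I` matrix over `k` and `D` its diagram (vertices `I`, an edge between
distinct `i, j` unless `a_{ij} = a_{ji} = 0`).  Assume `det(A_B) ≠ 0` for every
subdiagram `B ⊆ D` with `|I ∖ B| ≥ 2`.  Let `(h, Π, Π∨)` be a realisation of `A` of
minimal dimension `2|I| − rank(A)`.  Then there is a family of subspaces `h_B ⊆ h`,
indexed by the subdiagrams `B ⊆ D`, with `h_D = h`, such that for every `B`: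
(a) the span of `{h_i^∨ : i ∈ B}` is contained in `h_B`; (b) the restrictions of the
`{α_i}_{i∈B}` to `h_B` are linearly independent; (c) `dim h_B = 2|B| − rank(A_B)`;
and for all `B, B'`: (d) `h_{B'} ⊆ h_B` whenever `B' ⊆ B`; (e) if `B` and `B'` are
orthogonal then `h_B ⊆ ⋂_{j∈B'} ker α_j` and `h_{B'} ⊆ ⋂_{i∈B} ker α_i`. -/
theorem exists_cartan_diagrammatic_structure {k : Type*} [Field k] [CharZero k]
    {I : Type*} [Fintype I] [DecidableEq I] (A : Matrix I I k)
    (hdet : ∀ B : Finset I, 2 ≤ (Finset.univ \ B).card →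
      (A.submatrix (fun b : B => (b : I)) (fun b : B => (b : I))).det ≠ 0)
    (V : Type*) [AddCommGroup V] [Module k V]
    (α : I → (V →ₗ[k] k)) (hv : I → V) (hreal : IsRealisation A V α hv)
    (hmin : Module.finrank k V = 2 * Fintype.card I - A.rank) :
    ∃ hB : Finset I → Submodule k V,
      hB Finset.univ = ⊤ ∧
      (∀ B : Finset I, ∀ i ∈ B, hv i ∈ hB B) ∧
      (∀ B : Finset I,
        LinearIndependent k (fun i : B => ((α i).domRestrict (hB B)))) ∧
      (∀ B : Finset I, Module.finrank k (hB B) =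
        2 * B.card - (A.submatrix (fun b : B => (b : I)) (fun b : B => (b : I))).rank) ∧
      (∀ B B' : Finset I, B' ⊆ B → hB B' ≤ hB B) ∧
      (∀ B B' : Finset I, Disjoint B B' →
        (∀ i ∈ B, ∀ j ∈ B', A i j = 0 ∧ A j i = 0) →
        (hB B ≤ ⨅ j ∈ B', LinearMap.ker (α j)) ∧
        (hB B' ≤ ⨅ i ∈ B, LinearMap.ker (α i))) := by
  have := hreal.finite
  choose W hmem hindep hrank hker using hreal.exists_submodule
  have htop : W Finset.univ = ⊤ := by
    apply Submodule.eq_top_of_finrank_eq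
    rw [hrank, hmin, Finset.card_univ]
    congr 1
    let e : (Finset.univ : Finset I) ≃ I := Equiv.subtypeUnivEquiv Finset.mem_univ
    exact Matrix.rank_submatrix A e e
  refine ⟨W, htop, hmem, hindep, hrank, fun B B' hBB' => ?_, fun B B' hdisj horth => ⟨?_, ?_⟩⟩
  · rcases eq_or_ne B Finset.univ with rfl | hB
    · exact htop ▸ le_top
    rcases eq_or_ne B' B with rfl | hB'
    · exact le_rfl
    have hcard : 2 ≤ (Finset.univ \ B').card := by
      have h₁ := Finset.card_lt_card (hBB'.ssubset_of_ne hB')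
      have h₂ := Finset.card_lt_card (B.subset_univ.ssubset_of_ne hB)
      rw [Finset.card_sdiff_of_subset B'.subset_univ]
      omega
    have hfull := Matrix.rank_of_isUnit _
      ((Matrix.isUnit_iff_isUnit_det _).mpr (isUnit_iff_ne_zero.mpr (hdet B' hcard)))
    have hspan : Submodule.span k (Set.range fun b : B' => hv b) = W B' := by
      apply Submodule.eq_of_le_of_finrank_eq
      · rw [Submodule.span_le]
        rintro _ ⟨i, rfl⟩
        exact hmem B' i i.2
      · rw [hrank, hfull, Fintype.card_coe]
        refine (finrank_span_eq_card (hreal.indep_h.comp _ Subtype.val_injective)).trans ?_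
        rw [Fintype.card_coe]
        omega
    rw [← hspan, Submodule.span_le]
    rintro _ ⟨i, rfl⟩
    exact hmem B i (hBB' i.2)
  · simp only [le_iInf_iff]
    exact fun j hj => hker B j (Finset.disjoint_right.mp hdisj hj) fun i hi => (horth i hi j hj).1
  · simp only [le_iInf_iff]
    exact fun i hi => hker B' i (Finset.disjoint_left.mp hdisj hi) fun j hj => (horth i hi j hj).2
end
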